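/- arXiv:2602.22512 — 3 statements merged into one kernel-verified Lean document; each statement's English description precedes it below -/
import Mathlib

section
/- Let $a,b,c,d\in\mathbb{R}$ with $1\le a\le b$, let $s\in(0,1)$, $\delta\in(0,1/2]$, and $\rho>1$. Then the Hausdorff pre-measure at scale $\rho$ of the set $E(\delta)=\{x\in[0,1]:\|ax+c\|\cdot\|bx+d\|<\delta^2\}$ satisfies $\mathcal{H}^s_\rho(E(\delta))\le C_s\,(b(\delta^2/b)^s L + a(\delta^2/(ab))^{s/2}L)$, where $C_s$ depends only on $s$ and $L=\max\{1,\frac{\log b}{a}\}$. -/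
open Set
open scoped ENNReal

/-- Distance from `x` to the nearest integer. -/
noncomputable def nint (x : ℝ) : ℝ := |x - round x|

/-- `log` with the convention that `log x = 1` for `x ≤ e`. -/
noncomputable def clog (x : ℝ) : ℝ := max 1 (Real.log x)

/-- Hausdorff `s`-pre-measure at scale `ρ`: infimum of `∑ rᵢ^s` over countable covers
of `F` by balls of radius `rᵢ < ρ`. -/
noncomputable def preH (s ρ : ℝ) (F : Set ℝ) : ℝ≥0∞ :=
  ⨅ (c : ℕ → ℝ) (r : ℕ → ℝ) (_ : ∀ n, 0 < r n ∧ r n < ρ)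
    (_ : F ⊆ ⋃ n, Metric.ball (c n) (r n)), ∑' n, ENNReal.ofReal (r n ^ s)

theorem preH_le_sum {ι : Type*} [Fintype ι] {s ρ : ℝ} (hs : 0 < s) (hρ : 0 < ρ) {F : Set ℝ}
    (c r : ι → ℝ) (hr : ∀ i, 0 < r i ∧ r i < ρ) (hF : F ⊆ ⋃ i, Metric.ball (c i) (r i)) :
    preH s ρ F ≤ ∑ i, ENNReal.ofReal (r i ^ s) := by
  refine ENNReal.le_of_forall_pos_le_add fun ε hε _ => ?_
  obtain ⟨ε', hε', hsum⟩ :=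
    ENNReal.exists_pos_sum_of_countable (ε := (ε : ℝ≥0∞)) (by exact_mod_cast hε.ne') ℕ
  obtain ⟨e⟩ : Nonempty (ℕ ≃ ι ⊕ ℕ) := nonempty_equiv_of_countable
  let t : ℕ → ℝ := fun n => min ((ε' n : ℝ) ^ s⁻¹) (ρ / 2)
  have ht0 : ∀ n, 0 < t n := fun n =>
    lt_min (Real.rpow_pos_of_pos (by exact_mod_cast hε' n) _) (by positivity)
  have ht1 : ∀ n, t n < ρ := fun n => (min_le_right _ _).trans_lt (by linarith)
  have hts : ∀ n, ENNReal.ofReal (t n ^ s) ≤ ε' n := fun n => by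
    rw [← ENNReal.ofReal_coe_nnreal]
    refine ENNReal.ofReal_le_ofReal ?_
    calc t n ^ s ≤ ((ε' n : ℝ) ^ s⁻¹) ^ s :=
          Real.rpow_le_rpow (ht0 n).le (min_le_left _ _) hs.le
      _ = ε' n := Real.rpow_inv_rpow (by positivity) hs.ne'
  let c' : ι ⊕ ℕ → ℝ := Sum.elim c fun _ => 0
  let r' : ι ⊕ ℕ → ℝ := Sum.elim r t
  have hr' : ∀ x, 0 < r' x ∧ r' x < ρ := by
    rintro (i | n)
    · exact hr i
    · exact ⟨ht0 n, ht1 n⟩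
  have hcov : F ⊆ ⋃ n, Metric.ball (c' (e n)) (r' (e n)) := fun x hx => by
    obtain ⟨i, hi⟩ := mem_iUnion.1 (hF hx)
    refine mem_iUnion.2 ⟨e.symm (Sum.inl i), ?_⟩
    simpa [c', r'] using hi
  calc preH s ρ F ≤ ∑' n, ENNReal.ofReal (r' (e n) ^ s) :=
        iInf_le_of_le (fun n => c' (e n)) <| iInf_le_of_le (fun n => r' (e n)) <|
          iInf_le_of_le (fun n => hr' (e n)) <| iInf_le_of_le hcov le_rfl
    _ = ∑' x, ENNReal.ofReal (r' x ^ s) := e.tsum_eq fun x => ENNReal.ofReal (r' x ^ s)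
    _ = ∑ i, ENNReal.ofReal (r i ^ s) + ∑' n, ENNReal.ofReal (t n ^ s) := by
        rw [Summable.tsum_sum ENNReal.summable ENNReal.summable, tsum_fintype]
        rfl
    _ ≤ ∑ i, ENNReal.ofReal (r i ^ s) + ε := by
        gcongr
        exact (ENNReal.tsum_le_tsum hts).trans hsum.le

/-- Radius used around the `n`-th zero away from a common near-zero. -/
noncomputable def coverRadius (q A : ℝ) (n : ℕ) : ℝ := if n < 2 then q else A / n

theorem one_sub_mul_rpow_le {s : ℝ} (hs0 : 0 < s) (hs1 : s < 1) {N : ℝ} (hN : 0 ≤ N) :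
    (1 - s) * (N + 1) ^ (-s) ≤ (N + 1) ^ (1 - s) - N ^ (1 - s) := by
  have ht : 0 < N + 1 := by linarith
  have h := rpow_one_add_le_one_add_mul_self (s := -(1 / (N + 1))) (p := 1 - s)
    (by rw [neg_le_neg_iff, div_le_one ht]; linarith) (by linarith) (by linarith)
  have e1 : 1 + -(1 / (N + 1)) = N / (N + 1) := by field_simp; ring
  rw [e1, Real.div_rpow hN ht.le, div_le_iff₀ (Real.rpow_pos_of_pos ht _)] at h
  have e2 : (N + 1) ^ (1 - s) = (N + 1) * (N + 1) ^ (-s) := by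
    rw [sub_eq_add_neg, Real.rpow_add ht, Real.rpow_one]
  have e3 : (1 + (1 - s) * -(1 / (N + 1))) * (N + 1) ^ (1 - s)
      = (N + 1) ^ (1 - s) - (1 - s) * (N + 1) ^ (-s) := by
    rw [e2]; field_simp; ring
  linarith

theorem sum_coverRadius_rpow_le {s : ℝ} (hs0 : 0 < s) (hs1 : s < 1) {q A : ℝ} (hq : 0 ≤ q)
    (hA : 0 ≤ A) (N : ℕ) :
    ∑ n ∈ Finset.range (N + 1), coverRadius q A n ^ s
      ≤ 2 * q ^ s + A ^ s * (N : ℝ) ^ (1 - s) / (1 - s) := by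
  have hs : 0 < 1 - s := by linarith
  have hqs : 0 ≤ q ^ s := Real.rpow_nonneg hq s
  have hAs : 0 ≤ A ^ s := Real.rpow_nonneg hA s
  induction N with
  | zero =>
    have : 0 ≤ A ^ s * ((0 : ℕ) : ℝ) ^ (1 - s) / (1 - s) := by positivity
    simp only [zero_add, Finset.sum_range_one, coverRadius]
    norm_num at this ⊢
    linarith
  | succ N ih =>
    rcases Nat.eq_zero_or_pos N with rfl | hN
    · have : 0 ≤ A ^ s * ((0 + 1 : ℕ) : ℝ) ^ (1 - s) / (1 - s) := by positivity
      simp only [Finset.sum_range_succ, Finset.sum_range_zero, coverRadius]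
      norm_num at this ⊢
      linarith
    · rw [Finset.sum_range_succ]
      have h2 : coverRadius q A (N + 1) ^ s = A ^ s * ((N : ℝ) + 1) ^ (-s) := by
        rw [coverRadius, if_neg (by omega), Real.div_rpow hA (by positivity),
          Real.rpow_neg (by positivity)]
        push_cast
        rfl
      have h3 := one_sub_mul_rpow_le hs0 hs1 (N := N) (by positivity)
      have h4 : ((N : ℝ) + 1) ^ (-s) ≤ (((N : ℝ) + 1) ^ (1 - s) - (N : ℝ) ^ (1 - s)) / (1 - s) := by
        rw [le_div_iff₀ hs]; linarith
      have h5 := mul_le_mul_of_nonneg_left h4 hAs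
      rw [h2]
      push_cast
      have h6 : A ^ s * ((((N : ℝ) + 1) ^ (1 - s) - (N : ℝ) ^ (1 - s)) / (1 - s))
        = A ^ s * ((N : ℝ) + 1) ^ (1 - s) / (1 - s) - A ^ s * (N : ℝ) ^ (1 - s) / (1 - s) := by
        ring
      linarith

/-- A point where both linear forms are jointly small is close to a zero `α` of the first,
or to a zero of the second lying within `b / (2 * a) + 1` steps of `α`. -/
theorem near_zero_of_nint_mul_lt {a b c d δ x : ℝ} (ha : 1 ≤ a) (hab : a ≤ b) (hδ : 0 < δ)
    (hx : nint (a * x + c) * nint (b * x + d) < δ ^ 2) :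
    let i := round (a * x + c)
    let α := (i - c) / a
    let q := √(δ ^ 2 / (a * b))
    |x - α| < q ∨ ∃ k : ℤ, k.natAbs ≤ ⌊b / (2 * a) + 1⌋₊ ∧
      |x - (round (b * α + d) + k - d) / b| < coverRadius q (2 * δ ^ 2 / a) k.natAbs := by
  intro i α q
  have ha0 : 0 < a := by linarith
  have hb0 : 0 < b := by linarith
  have hab0 : 0 < a * b := by positivity
  rw [or_iff_not_imp_left]
  intro hα
  push Not at hα
  set w : ℝ := b * α + d - round (b * α + d) with hw
  have hw2 : |w| ≤ 1 / 2 := abs_sub_round _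
  set u : ℝ := a * x + c - i with hu
  have hu2 : |u| ≤ 1 / 2 := abs_sub_round _
  set v : ℝ := b * x + d - round (b * x + d) with hv
  have hv2 : |v| ≤ 1 / 2 := abs_sub_round _
  have huv : |u| * |v| < δ ^ 2 := hx
  have hxα : x - α = u / a := by simp only [α, hu]; field_simp; ring
  set k : ℤ := round (b * x + d) - round (b * α + d) with hk
  have hkr : (k : ℝ) = b / a * u - v + w := by
    have : b * (x - α) = b / a * u := by rw [hxα]; ring
    simp only [hk, hv, hw]; push_cast; linarith
  have hba : 0 ≤ b / a := by positivity
  have hku : |(k : ℝ)| ≤ b / a * |u| + 1 := by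
    rw [hkr]
    calc |b / a * u - v + w| ≤ |b / a * u - v| + |w| := abs_add_le _ _
      _ ≤ |b / a * u| + |v| + |w| := by gcongr; exact abs_sub _ _
      _ ≤ b / a * |u| + 1 := by rw [abs_mul, abs_of_nonneg hba]; linarith
  have hnat : ((k.natAbs : ℕ) : ℝ) = |(k : ℝ)| := by
    rw [Nat.cast_natAbs]; push_cast; rfl
  refine ⟨k, ?_, ?_⟩
  · refine Nat.le_floor ?_
    rw [hnat]
    have := mul_le_mul_of_nonneg_left hu2 hba
    have e : b / (2 * a) = b / a * (1 / 2) := by field_simp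
    linarith
  · have hβ : x - (round (b * α + d) + k - d) / b = v / b := by
      simp only [hk, hv]; push_cast; field_simp; ring
    rw [hβ, abs_div, abs_of_pos hb0, div_lt_iff₀ hb0]
    rw [hxα, abs_div, abs_of_pos ha0, le_div_iff₀ ha0] at hα
    have hq0 : 0 < q := Real.sqrt_pos.2 (by positivity)
    have hq2 : q * q * (a * b) = δ ^ 2 := by
      rw [Real.mul_self_sqrt (by positivity)]; field_simp
    rw [coverRadius]
    split_ifs with hk2
    · by_contra! hcon
      have := mul_le_mul hα hcon (by positivity) (abs_nonneg _)
      nlinarith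
    · have hk2' : (2 : ℝ) ≤ |(k : ℝ)| := by
        rw [← hnat]; exact_mod_cast not_lt.1 hk2
      rw [hnat]
      have hk0 : 0 < |(k : ℝ)| := by linarith
      have h1 : |(k : ℝ)| / 2 ≤ b / a * |u| := by linarith
      have h2 : |(k : ℝ)| * a ≤ 2 * b * |u| := by
        have := mul_le_mul_of_nonneg_right h1 ha0.le
        have e : b / a * |u| * a = b * |u| := by field_simp
        linarith
      have e : 2 * δ ^ 2 / a / |(k : ℝ)| * b = (2 * b * δ ^ 2) / (|(k : ℝ)| * a) := by
        field_simp
      rw [e, lt_div_iff₀ (by positivity)]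
      calc |v| * (|(k : ℝ)| * a) ≤ |v| * (2 * b * |u|) := by gcongr
        _ = 2 * b * (|u| * |v|) := by ring
        _ < 2 * b * δ ^ 2 := by gcongr

theorem card_Icc_round_le (a c : ℝ) (ha : 1 ≤ a) :
    ((Finset.Icc (round c) (round (a + c))).card : ℝ) ≤ 3 * a := by
  have h1 := abs_le.1 (abs_sub_round c)
  have h2 := abs_le.1 (abs_sub_round (a + c))
  have h3 : round c ≤ round (a + c) + 1 := by
    have : ((round c : ℤ) : ℝ) ≤ ((round (a + c) + 1 : ℤ) : ℝ) := by push_cast; linarith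
    exact_mod_cast this
  have h4 : ((Finset.Icc (round c) (round (a + c))).card : ℝ)
      = round (a + c) + 1 - round c := by
    have := Int.card_Icc_of_le _ _ h3
    exact_mod_cast this
  rw [h4]
  linarith

theorem round_le_round_of_le {x y : ℝ} (h : x ≤ y) : round x ≤ round y := by
  rw [round_eq, round_eq]
  exact Int.floor_mono (by linarith)

theorem preH_nint_mul_le {s : ℝ} (hs0 : 0 < s) (hs1 : s < 1) {a b c d δ ρ : ℝ} (ha : 1 ≤ a)
    (hab : a ≤ b) (hδ : 0 < δ) (hδ2 : δ ≤ 1 / 2) (hρ : 1 < ρ) :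
    preH s ρ {x ∈ Icc (0:ℝ) 1 | nint (a * x + c) * nint (b * x + d) < δ ^ 2}
      ≤ ENNReal.ofReal (15 / (1 - s) *
        (b * (δ ^ 2 / b) ^ s + a * (δ ^ 2 / (a * b)) ^ (s / 2))) := by
  have ha0 : 0 < a := by linarith
  have hb0 : 0 < b := by linarith
  have hs : 0 < 1 - s := by linarith
  have hδ4 : δ ^ 2 ≤ 1 / 4 := by nlinarith
  set q := √(δ ^ 2 / (a * b)) with hq
  set A := 2 * δ ^ 2 / a with hA
  set K := ⌊b / (2 * a) + 1⌋₊ with hK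
  have hq0 : 0 < q := Real.sqrt_pos.2 (by positivity)
  have hA0 : 0 < A := by positivity
  have hq1 : q ≤ 1 := by
    rw [hq, Real.sqrt_le_iff, one_pow, div_le_one (by positivity)]
    refine ⟨zero_le_one, ?_⟩
    nlinarith
  have hA1 : A ≤ 1 := by
    rw [hA, div_le_one ha0]; linarith
  have hR0 : ∀ n, 0 < coverRadius q A n := fun n => by
    rw [coverRadius]; split_ifs with h
    · exact hq0
    · have : 0 < n := by omega
      positivity
  have hR1 : ∀ n, coverRadius q A n ≤ 1 := fun n => by
    rw [coverRadius]; split_ifs with h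
    · exact hq1
    · have : (1 : ℝ) ≤ n := by exact_mod_cast (by omega : 1 ≤ n)
      exact (div_le_self hA0.le this).trans hA1
  let I := Finset.Icc (round c) (round (a + c))
  let α : ℤ → ℝ := fun i => (i - c) / a
  let cen : I × Option (Bool × Fin (K + 1)) → ℝ := fun p =>
    p.2.elim (α p.1)
      fun t => (round (b * α p.1 + d) + (if t.1 then (t.2 : ℝ) else -(t.2 : ℝ)) - d) / b
  let rad : I × Option (Bool × Fin (K + 1)) → ℝ := fun p =>
    p.2.elim q fun t => coverRadius q A t.2
  have hrad : ∀ p, 0 < rad p ∧ rad p < ρ := by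
    rintro ⟨i, _ | t⟩
    · exact ⟨hq0, hq1.trans_lt hρ⟩
    · exact ⟨hR0 _, (hR1 _).trans_lt hρ⟩
  have hcov : {x ∈ Icc (0:ℝ) 1 | nint (a * x + c) * nint (b * x + d) < δ ^ 2}
      ⊆ ⋃ p, Metric.ball (cen p) (rad p) := by
    rintro x ⟨⟨hx0, hx1⟩, hx⟩
    have hi : round (a * x + c) ∈ I :=
      Finset.mem_Icc.2 ⟨round_le_round_of_le (by nlinarith), round_le_round_of_le (by nlinarith)⟩
    rw [mem_iUnion]
    rcases near_zero_of_nint_mul_lt ha hab hδ hx with h | ⟨k, hk, h⟩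
    · exact ⟨(⟨_, hi⟩, none), by rw [Metric.mem_ball, Real.dist_eq]; exact h⟩
    · refine ⟨(⟨_, hi⟩, some (decide (0 ≤ k), ⟨k.natAbs, Nat.lt_succ_of_le hk⟩)), ?_⟩
      rw [Metric.mem_ball, Real.dist_eq]
      have e : (if decide (0 ≤ k) = true then ((k.natAbs : ℕ) : ℝ) else -((k.natAbs : ℕ) : ℝ))
          = k := by
        rw [Nat.cast_natAbs]
        by_cases h0 : 0 ≤ k
        · simp [h0, abs_of_nonneg h0]
        · simp [h0, abs_of_neg (not_le.1 h0)]
      simp only [cen, rad, Option.elim_some]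
      rw [e]
      exact h
  refine (preH_le_sum hs0 (by linarith) cen rad hrad hcov).trans ?_
  rw [← ENNReal.ofReal_sum_of_nonneg fun p _ => Real.rpow_nonneg (hrad p).1.le s]
  refine ENNReal.ofReal_le_ofReal ?_
  have hsum : ∑ p, rad p ^ s
      = (I.card : ℝ) * (q ^ s + 2 * ∑ n ∈ Finset.range (K + 1), coverRadius q A n ^ s) := by
    simp only [rad, Fintype.sum_prod_type, Fintype.sum_option, Option.elim_none,
      Option.elim_some, Finset.sum_const, Finset.card_univ, Fintype.card_bool, nsmul_eq_mul,
      Fintype.card_coe, Finset.sum_range]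
    push_cast
    ring
  have hqs : q ^ s = (δ ^ 2 / (a * b)) ^ (s / 2) := by
    rw [hq, Real.sqrt_eq_rpow, ← Real.rpow_mul (by positivity)]
    congr 1; ring
  have hKle : (K : ℝ) ≤ 2 * b / a := by
    refine (Nat.floor_le (by positivity)).trans ?_
    have h1 : 1 ≤ b / a := by rwa [one_le_div ha0]
    have e1 : b / (2 * a) = b / a / 2 := by field_simp
    have e2 : 2 * b / a = 2 * (b / a) := by ring
    linarith
  have hAK : A ^ s * (K : ℝ) ^ (1 - s) ≤ 2 / a * (b * (δ ^ 2 / b) ^ s) := by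
    calc A ^ s * (K : ℝ) ^ (1 - s) ≤ A ^ s * (2 * b / a) ^ (1 - s) := by gcongr
      _ = (δ ^ 2 / b * (2 * b / a)) ^ s * (2 * b / a) ^ (1 - s) := by
          congr 2; rw [hA]; field_simp
      _ = (δ ^ 2 / b) ^ s * ((2 * b / a) ^ s * (2 * b / a) ^ (1 - s)) := by
          rw [Real.mul_rpow (by positivity) (by positivity)]; ring
      _ = 2 / a * (b * (δ ^ 2 / b) ^ s) := by
          rw [← Real.rpow_add (by positivity)]
          rw [add_sub_cancel, Real.rpow_one]; ring
  have hS := sum_coverRadius_rpow_le hs0 hs1 hq0.le hA0.le K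
  have hAK' := div_le_div_of_nonneg_right hAK hs.le
  rw [hsum, ← hqs]
  set P := b * (δ ^ 2 / b) ^ s with hP
  set Q := q ^ s with hQ
  have hP0 : 0 ≤ P := by positivity
  have hQ0 : 0 ≤ Q := by positivity
  have h1s : 1 ≤ 1 / (1 - s) := by rw [one_le_div hs]; linarith
  calc (I.card : ℝ) * (Q + 2 * ∑ n ∈ Finset.range (K + 1), coverRadius q A n ^ s)
      ≤ 3 * a * (Q + 2 * (2 * Q + 2 / a * P / (1 - s))) := by
        gcongr
        · have : 0 ≤ ∑ n ∈ Finset.range (K + 1), coverRadius q A n ^ s :=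
            Finset.sum_nonneg fun n _ => Real.rpow_nonneg (hR0 n).le s
          positivity
        · exact card_Icc_round_le a c ha
        · linarith
    _ = 15 * (a * Q) * 1 + 12 * P * (1 / (1 - s)) := by field_simp; ring
    _ ≤ 15 * (a * Q) * (1 / (1 - s)) + 15 * P * (1 / (1 - s)) := by gcongr; norm_num
    _ = 15 / (1 - s) * (P + a * Q) := by ring

theorem stmt3 (s : ℝ) (hs0 : 0 < s) (hs1 : s < 1) :
    ∃ C : ℝ, 0 < C ∧ ∀ (a b c d δ ρ : ℝ), 1 ≤ a → a ≤ b →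
      0 < δ → δ ≤ 1 / 2 → 1 < ρ →
      preH s ρ {x ∈ Icc (0:ℝ) 1 | nint (a * x + c) * nint (b * x + d) < δ ^ 2}
        ≤ ENNReal.ofReal (C * (b * (δ ^ 2 / b) ^ s * max 1 (clog b / a)
            + a * (δ ^ 2 / (a * b)) ^ (s / 2) * max 1 (clog b / a))) := by
  have hs : 0 < 1 - s := by linarith
  refine ⟨15 / (1 - s), by positivity, fun a b c d δ ρ ha hab hδ hδ2 hρ => ?_⟩
  refine (preH_nint_mul_le hs0 hs1 ha hab hδ hδ2 hρ).trans (ENNReal.ofReal_le_ofReal ?_)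
  have ha0 : 0 < a := by linarith
  have hb0 : 0 < b := by linarith
  have hL : 1 ≤ max 1 (clog b / a) := le_max_left _ _
  refine mul_le_mul_of_nonneg_left (add_le_add ?_ ?_) (by positivity)
  · exact le_mul_of_one_le_right (by positivity) hL
  · exact le_mul_of_one_le_right (by positivity) hL
end

section
/- Let $\{a_n\},\{b_n\}$ be sequences of positive integers and $\{c_n\},\{d_n\}$ real sequences with $a_n\le b_n$, and let $\psi:\mathbb{N}\to[0,\infty)$ and $s\in(0,1)$. If $\sum_{n\in\mathbb{N}}b_n(\psi(n)/b_n)^s+\sum_{n\in\mathbb{N}}\gcd(a_n,b_n)(\psi(n)/(a_nb_n))^{s/2}<\infty$, then $\mathcal{H}^s(M(\psi))=0$, where $M(\psi)=\{x\in[0,1]:\|a_nx+c_n\|\cdot\|b_nx+d_n\|<\psi(n)\text{ for infinitely many }n\}$. -/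
open Set MeasureTheory
open scoped ENNReal

open Filter Topology in
/-- The Hausdorff–Cantelli lemma: a limsup set whose pieces have covers with summable `s`-costs is
`μH[s]`-null. -/
theorem hausdorffMeasure_limsup_eq_zero {ι X : Type*} [Countable ι] [EMetricSpace X]
    [MeasurableSpace X] [BorelSpace X] {s : ℝ} (hs : 0 < s) (E : ℕ → Set X)
    (F : ℕ → Finset ι) (U : ℕ → ι → Set X) (hcov : ∀ n, E n ⊆ ⋃ i ∈ F n, U n i)
    (hsum : ∑' n, ∑ i ∈ F n, Metric.ediam (U n i) ^ s ≠ ⊤) :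
    μH[s] {x | {n : ℕ | x ∈ E n}.Infinite} = 0 := by
  set f : ℕ → ℝ≥0∞ := fun n => ∑ i ∈ F n, Metric.ediam (U n i) ^ s with hf
  have htail : Tendsto (fun N => ∑' k, f (k + N)) atTop (𝓝 0) :=
    ENNReal.tendsto_sum_nat_add f hsum
  have htsum : ∀ N, ∑' j : (Σ k : ℕ, {i // i ∈ F (k + N)}),
      Metric.ediam (U (j.1 + N) j.2.1) ^ s = ∑' k, f (k + N) := by
    intro N
    rw [ENNReal.tsum_sigma']
    refine tsum_congr fun k => ?_
    exact Finset.tsum_subtype (F (k + N)) (fun i => Metric.ediam (U (k + N) i) ^ s)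
  have hroot : Tendsto (fun N => (∑' k, f (k + N)) ^ s⁻¹) atTop (𝓝 0) := by
    have := htail.ennrpow_const s⁻¹
    rwa [ENNReal.zero_rpow_of_pos (inv_pos.2 hs)] at this
  have hle := Measure.hausdorffMeasure_le_liminf_tsum
    (ι := fun N => Σ k : ℕ, {i // i ∈ F (k + N)}) s
    {x | {n : ℕ | x ∈ E n}.Infinite} (fun N => (∑' k, f (k + N)) ^ s⁻¹) hroot
    (fun N j => U (j.1 + N) j.2.1) ?_ ?_
  · simp only [htsum] at hle
    rw [htail.liminf_eq] at hle
    exact le_antisymm hle (zero_le)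
  · refine Eventually.of_forall fun N j => ?_
    rw [ENNReal.le_rpow_inv_iff hs, ← htsum]
    exact ENNReal.le_tsum (f := fun j : (Σ k : ℕ, {i // i ∈ F (k + N)}) =>
      Metric.ediam (U (j.1 + N) j.2.1) ^ s) j
  · refine Eventually.of_forall fun N x hx => ?_
    obtain ⟨n, hn, hNn⟩ := Set.Infinite.exists_gt hx N
    obtain ⟨k, rfl⟩ := Nat.exists_eq_add_of_le' hNn.le
    have := hcov _ hn
    simp only [mem_iUnion] at this ⊢
    obtain ⟨i, hi, hxi⟩ := this
    exact ⟨⟨k, i, hi⟩, hxi⟩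

theorem sum_range_rpow_neg_le {s : ℝ} (hs0 : 0 < s) (hs1 : s < 1) (N : ℕ) :
    ∑ i ∈ Finset.range N, ((i + 1 : ℕ) : ℝ) ^ (-s) ≤ (N : ℝ) ^ (1 - s) / (1 - s) := by
  have hs : 0 < 1 - s := by linarith
  induction N with
  | zero => simp [Real.zero_rpow hs.ne']
  | succ N ih =>
    rw [Finset.sum_range_succ]
    have hN : (0 : ℝ) < ((N + 1 : ℕ) : ℝ) := by positivity
    have hfac : (N : ℝ) = ((N + 1 : ℕ) : ℝ) * (1 + -1 / ((N + 1 : ℕ) : ℝ)) := by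
      field_simp; push_cast; ring
    have hinv : -1 ≤ -1 / ((N + 1 : ℕ) : ℝ) := by
      rw [le_div_iff₀ hN]; push_cast; linarith [(Nat.cast_nonneg N : (0 : ℝ) ≤ N)]
    have hbern := rpow_one_add_le_one_add_mul_self hinv hs.le (by linarith)
    have hpow : ((N + 1 : ℕ) : ℝ) ^ (-s) = ((N + 1 : ℕ) : ℝ) ^ (1 - s) / ((N + 1 : ℕ) : ℝ) := by
      rw [← Real.rpow_sub_one hN.ne']; congr 1; ring
    have hkey : (N : ℝ) ^ (1 - s) ≤
        ((N + 1 : ℕ) : ℝ) ^ (1 - s) - (1 - s) * ((N + 1 : ℕ) : ℝ) ^ (-s) := by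
      calc (N : ℝ) ^ (1 - s)
          = ((N + 1 : ℕ) : ℝ) ^ (1 - s) * (1 + -1 / ((N + 1 : ℕ) : ℝ)) ^ (1 - s) := by
            rw [← Real.mul_rpow hN.le (by linarith), ← hfac]
        _ ≤ ((N + 1 : ℕ) : ℝ) ^ (1 - s) * (1 + (1 - s) * (-1 / ((N + 1 : ℕ) : ℝ))) := by
            gcongr
        _ = _ := by rw [hpow]; ring
    calc _ ≤ (N : ℝ) ^ (1 - s) / (1 - s) + ((N + 1 : ℕ) : ℝ) ^ (-s) := by gcongr
      _ ≤ _ := by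
        rw [le_div_iff₀ hs, add_mul, div_mul_cancel₀ _ hs.ne']; linarith

/-- The determinant `b (p - c) - a (q - d)`, which is `a b` times the distance between the zeros
of `a x + c - p` and `b x + d - q`. -/
noncomputable def zeroGap (a b : ℕ) (c d : ℝ) (z : ℤ × ℤ) : ℝ :=
  b * (z.1 - c) - a * (z.2 - d)

/-- The pairs of nearest integers to `(a x + c, b x + d)` that can occur for `x ∈ [0, 1]`. -/
noncomputable def nearPairs (a b : ℕ) (c d : ℝ) : Finset (ℤ × ℤ) :=
  (Finset.Icc (round c) (round c + a) ×ˢ Finset.Icc (round d) (round d + b)).filter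
    fun z => |zeroGap a b c d z| ≤ b

/-- The gap of a pair, counted in multiples of `gcd a b`. -/
noncomputable def gapLevel (a b : ℕ) (c d : ℝ) (z : ℤ × ℤ) : ℕ :=
  ⌊|zeroGap a b c d z| / (Nat.gcd a b : ℝ)⌋₊

/-- The radius of the covering intervals for pairs at gap level `i`. -/
noncomputable def levelRadius (a b : ℕ) (ψ : ℝ) (i : ℕ) : ℝ :=
  if i = 0 then √(ψ / (a * b)) else 2 * ψ / (Nat.gcd a b * i)

theorem levelRadius_nonneg (a b : ℕ) {ψ : ℝ} (hψ : 0 ≤ ψ) (i : ℕ) :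
    0 ≤ levelRadius a b ψ i := by
  unfold levelRadius; split_ifs <;> positivity

/-- The zero of `a x + c - p` or of `b x + d - q`. -/
noncomputable def zeroOf (a b : ℕ) (c d : ℝ) (z : (ℤ × ℤ) × Bool) : ℝ :=
  if z.2 then (z.1.1 - c) / a else (z.1.2 - d) / b

theorem card_gapLevel_fiber_le {a b : ℕ} (ha : 1 ≤ a) (hab : a ≤ b) (c d : ℝ) (i : ℕ) :
    ((nearPairs a b c d).filter fun z => gapLevel a b c d z = i).card ≤ 4 * Nat.gcd a b := by
  have hb : 0 < b := by omega
  have hg : 0 < Nat.gcd a b := Nat.gcd_pos_of_pos_left _ ha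
  obtain ⟨a', ha'⟩ := Nat.gcd_dvd_left a b
  obtain ⟨b', hb'⟩ := Nat.gcd_dvd_right a b
  have hco : Nat.Coprime a' b' := by
    have := Nat.coprime_div_gcd_div_gcd (m := a) (n := b) hg
    rwa [Nat.div_eq_of_eq_mul_right hg ha', Nat.div_eq_of_eq_mul_right hg hb'] at this
  set g := Nat.gcd a b with hgdef
  have hb'0 : 0 < b' := by
    rcases Nat.eq_zero_or_pos b' with h | h
    · simp [h] at hb'; omega
    · exact h
  have hg0 : (0 : ℝ) < g := by exact_mod_cast hg
  let T : Finset (Bool × ℤ) := Finset.univ ×ˢ Finset.Icc (0 : ℤ) g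
  have hT : T.card ≤ 4 * g := by
    simp only [T, Finset.card_product, Int.card_Icc, Finset.card_univ, Fintype.card_bool]
    omega
  refine le_trans (Finset.card_le_card_of_injOn
    (fun z => (decide (0 ≤ zeroGap a b c d z), (z.2 - round d) / (b' : ℤ))) ?_ ?_) hT
  · intro z hz
    simp only [nearPairs, Finset.coe_filter, Finset.mem_filter, Finset.mem_product,
      Finset.mem_Icc, mem_ofPred_eq] at hz
    obtain ⟨⟨⟨-, hq1, hq2⟩, -⟩, -⟩ := hz
    simp only [T, Finset.coe_product, Finset.coe_univ, Finset.coe_Icc, mem_prod, mem_univ,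
      true_and, mem_Icc]
    refine ⟨Int.ediv_nonneg (by omega) (by omega), ?_⟩
    refine Int.ediv_le_of_le_mul (by exact_mod_cast hb'0) ?_
    have : (b : ℤ) = g * b' := by exact_mod_cast hb'
    linarith
  · intro z hz w hw hzw
    simp only [Finset.coe_filter, mem_ofPred_eq] at hz hw
    simp only [Prod.mk.injEq, decide_eq_decide] at hzw
    obtain ⟨hsgn, hdiv⟩ := hzw
    have hlev : ∀ y : ℤ × ℤ, gapLevel a b c d y = i →
        i * (g : ℝ) ≤ |zeroGap a b c d y| ∧ |zeroGap a b c d y| < (i + 1) * g := by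
      intro y hy
      have := (Nat.floor_eq_iff (by positivity)).1 hy
      rw [le_div_iff₀ hg0, div_lt_iff₀ hg0] at this
      exact this
    obtain ⟨hz1, hz2⟩ := hlev z hz.2
    obtain ⟨hw1, hw2⟩ := hlev w hw.2
    have hdiff : |zeroGap a b c d z - zeroGap a b c d w| < g := by
      rw [abs_lt]
      by_cases h : 0 ≤ zeroGap a b c d z
      · have h' := hsgn.1 h
        rw [abs_of_nonneg h] at hz1 hz2
        rw [abs_of_nonneg h'] at hw1 hw2
        constructor <;> linarith
      · have h' := fun h0 => h (hsgn.2 h0)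
        rw [abs_of_neg (not_le.1 h)] at hz1 hz2
        rw [abs_of_neg (not_le.1 h')] at hw1 hw2
        constructor <;> linarith
    have hint : zeroGap a b c d z - zeroGap a b c d w =
        g * ((b' * (z.1 - w.1) - a' * (z.2 - w.2) : ℤ) : ℝ) := by
      have h1 : (a : ℝ) = g * a' := by exact_mod_cast ha'
      have h2 : (b : ℝ) = g * b' := by exact_mod_cast hb'
      unfold zeroGap
      rw [h1, h2]; push_cast; ring
    have hzero : (b' : ℤ) * (z.1 - w.1) - a' * (z.2 - w.2) = 0 := by
      rw [hint, abs_mul, abs_of_pos hg0] at hdiff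
      have : |((b' * (z.1 - w.1) - a' * (z.2 - w.2) : ℤ) : ℝ)| < 1 := by
        by_contra! h
        nlinarith
      rw [← Int.cast_abs] at this
      exact Int.abs_lt_one_iff.1 (by exact_mod_cast this)
    have hdvd : (b' : ℤ) ∣ z.2 - w.2 := by
      have h : (b' : ℤ) ∣ a' * (z.2 - w.2) := ⟨z.1 - w.1, by linarith⟩
      exact (Int.isCoprime_iff_gcd_eq_one.2 (by simpa using hco.symm)).dvd_of_dvd_mul_left h
    have hq : z.2 = w.2 := by
      have hmod : (z.2 - round d) % (b' : ℤ) = (w.2 - round d) % (b' : ℤ) := by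
        rw [Int.emod_eq_emod_iff_emod_sub_eq_zero, sub_sub_sub_cancel_right]
        exact Int.emod_eq_zero_of_dvd hdvd
      have e1 := Int.emod_add_mul_ediv (z.2 - round d) b'
      have e2 := Int.emod_add_mul_ediv (w.2 - round d) b'
      rw [hmod, hdiv] at e1
      linarith
    have hp : z.1 = w.1 := by
      rw [hq, sub_self, mul_zero, sub_zero] at hzero
      rcases mul_eq_zero.1 hzero with h | h
      · omega
      · omega
    exact Prod.ext hp hq

theorem mem_iUnion_closedBall_of_nint_mul_lt {a b : ℕ} (ha : 1 ≤ a) (hab : a ≤ b) (c d : ℝ)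
    {ψ : ℝ} {x : ℝ} (hx : x ∈ Icc (0 : ℝ) 1)
    (h : nint (a * x + c) * nint (b * x + d) < ψ) :
    x ∈ ⋃ z ∈ nearPairs a b c d ×ˢ (Finset.univ : Finset Bool),
      Metric.closedBall (zeroOf a b c d z) (levelRadius a b ψ (gapLevel a b c d z.1)) := by
  have ha0 : (0 : ℝ) < a := by exact_mod_cast ha
  have hab' : (a : ℝ) ≤ b := by exact_mod_cast hab
  have hb0 : (0 : ℝ) < b := ha0.trans_le hab'
  have hg0 : (0 : ℝ) < Nat.gcd a b := by exact_mod_cast Nat.gcd_pos_of_pos_left _ ha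
  set p := round (a * x + c) with hp
  set q := round (b * x + d) with hq
  have hu := abs_sub_round (a * x + c)
  have hv := abs_sub_round (b * x + d)
  rw [nint, nint, ← hp, ← hq] at h
  rw [← hp] at hu
  rw [← hq] at hv
  set u := a * x + c - p with hudef
  set v := b * x + d - q with hvdef
  have hgap : zeroGap a b c d (p, q) = a * v - b * u := by
    simp only [zeroGap, hudef, hvdef]; ring
  have hgaple : |zeroGap a b c d (p, q)| ≤ a * |v| + b * |u| := by
    rw [hgap]
    refine (abs_sub _ _).trans ?_
    rw [abs_mul, abs_mul, abs_of_pos ha0, abs_of_pos hb0]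
  have round_mem : ∀ (k : ℕ) (e : ℝ),
      round (k * x + e) ∈ Finset.Icc (round e) (round e + k) := by
    intro k e
    have hk : (0 : ℝ) ≤ k := k.cast_nonneg
    rw [Finset.mem_Icc, ← round_add_natCast, round_eq, round_eq, round_eq]
    constructor <;> apply Int.floor_mono
    · nlinarith [hx.1]
    · nlinarith [hx.2]
  have hmem : (p, q) ∈ nearPairs a b c d := by
    simp only [nearPairs, Finset.mem_filter, Finset.mem_product]
    refine ⟨⟨round_mem a c, round_mem b d⟩, hgaple.trans ?_⟩
    nlinarith
  have hdist : |u| / a ≤ levelRadius a b ψ (gapLevel a b c d (p, q)) ∨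
      |v| / b ≤ levelRadius a b ψ (gapLevel a b c d (p, q)) := by
    unfold levelRadius
    split_ifs with hi
    · by_contra! hcon
      obtain ⟨h1, h2⟩ := hcon
      have := mul_lt_mul'' h1 h2 (Real.sqrt_nonneg _) (Real.sqrt_nonneg _)
      have hψ : 0 ≤ ψ := le_trans (by positivity) h.le
      rw [Real.mul_self_sqrt (by positivity), div_mul_div_comm,
        div_lt_div_iff_of_pos_right (by positivity)] at this
      linarith
    · have hfl : (gapLevel a b c d (p, q) : ℝ) * Nat.gcd a b ≤ |zeroGap a b c d (p, q)| := by
        rw [← le_div_iff₀ hg0]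
        exact Nat.floor_le (by positivity)
      have hi0 : (0 : ℝ) < gapLevel a b c d (p, q) := by exact_mod_cast Nat.pos_of_ne_zero hi
      set t := (gapLevel a b c d (p, q) : ℝ)
      have hgt : 0 < Nat.gcd a b * t := by positivity
      rw [div_le_div_iff₀ ha0 hgt, div_le_div_iff₀ hb0 hgt]
      rcases le_total (b * |u|) (a * |v|) with hc | hc
      · left
        have : Nat.gcd a b * t ≤ 2 * (a * |v|) := by linarith
        nlinarith [mul_le_mul_of_nonneg_left this (abs_nonneg u)]
      · right
        have : Nat.gcd a b * t ≤ 2 * (b * |u|) := by linarith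
        nlinarith [mul_le_mul_of_nonneg_left this (abs_nonneg v)]
  simp only [mem_iUnion, Finset.mem_product, Finset.mem_univ, and_true]
  rcases hdist with hd | hd
  · refine ⟨((p, q), true), hmem, ?_⟩
    rw [Metric.mem_closedBall, Real.dist_eq]
    have : x - zeroOf a b c d ((p, q), true) = u / a := by
      simp only [zeroOf, hudef, if_true]; field_simp; ring
    rwa [this, abs_div, abs_of_pos ha0]
  · refine ⟨((p, q), false), hmem, ?_⟩
    rw [Metric.mem_closedBall, Real.dist_eq]
    have : x - zeroOf a b c d ((p, q), false) = v / b := by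
      simp only [zeroOf, hvdef, Bool.false_eq_true, if_false]; field_simp; ring
    rwa [this, abs_div, abs_of_pos hb0]

theorem sum_levelRadius_rpow_le {a b : ℕ} (ha : 1 ≤ a) (hab : a ≤ b) (c d : ℝ) {ψ s : ℝ}
    (hψ : 0 ≤ ψ) (hs0 : 0 < s) (hs1 : s < 1) :
    ∑ z ∈ nearPairs a b c d, levelRadius a b ψ (gapLevel a b c d z) ^ s ≤
      4 * (2 ^ s / (1 - s) * ((b : ℝ) * (ψ / b) ^ s)
        + (Nat.gcd a b : ℝ) * (ψ / (a * b)) ^ (s / 2)) := by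
  have ha0 : (0 : ℝ) < a := by exact_mod_cast ha
  have hb0 : (0 : ℝ) < b := by exact_mod_cast (by omega : 0 < b)
  have hg : 0 < Nat.gcd a b := Nat.gcd_pos_of_pos_left _ ha
  obtain ⟨N, hN⟩ := Nat.gcd_dvd_right a b
  have hg0 : (0 : ℝ) < Nat.gcd a b := by exact_mod_cast hg
  have hbN : (b : ℝ) = Nat.gcd a b * N := by exact_mod_cast hN
  have hN0 : (0 : ℝ) < N := by
    by_contra! h
    nlinarith
  have hmaps : ∀ z ∈ nearPairs a b c d, gapLevel a b c d z ∈ Finset.range (N + 1) := by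
    intro z hz
    simp only [nearPairs, Finset.mem_filter] at hz
    rw [Finset.mem_range, Nat.lt_succ_iff]
    refine Nat.floor_le_of_le ?_
    rw [div_le_iff₀ hg0, mul_comm, ← hbN]
    exact hz.2
  have hzero : levelRadius a b ψ 0 ^ s = (ψ / (a * b)) ^ (s / 2) := by
    rw [levelRadius, if_pos rfl, Real.sqrt_eq_rpow, ← Real.rpow_mul (by positivity)]
    congr 1; ring
  have hsucc : ∀ i : ℕ, levelRadius a b ψ (i + 1) ^ s =
      (2 * ψ / Nat.gcd a b) ^ s * ((i + 1 : ℕ) : ℝ) ^ (-s) := by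
    intro i
    rw [levelRadius, if_neg (Nat.succ_ne_zero i), Real.rpow_neg (by positivity), ← div_eq_mul_inv,
      ← Real.div_rpow (by positivity) (by positivity), div_div]
  have hscale : (Nat.gcd a b : ℝ) * ((2 * ψ / Nat.gcd a b) ^ s * (N : ℝ) ^ (1 - s)) =
      2 ^ s * ((b : ℝ) * (ψ / b) ^ s) := by
    have h2 : 2 * ψ / Nat.gcd a b = 2 * (ψ / b) * N := by
      rw [hbN]; field_simp
    rw [h2, Real.mul_rpow (by positivity) hN0.le, Real.mul_rpow (by positivity) (by positivity),
      mul_assoc, ← Real.rpow_add hN0, add_sub_cancel, Real.rpow_one]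
    rw [show (b : ℝ) * (ψ / b) ^ s = Nat.gcd a b * N * (ψ / b) ^ s by rw [← hbN]]
    ring
  calc ∑ z ∈ nearPairs a b c d, levelRadius a b ψ (gapLevel a b c d z) ^ s
      = ∑ i ∈ Finset.range (N + 1), ∑ z ∈ nearPairs a b c d with gapLevel a b c d z = i,
          levelRadius a b ψ (gapLevel a b c d z) ^ s :=
        (Finset.sum_fiberwise_of_maps_to hmaps _).symm
    _ ≤ ∑ i ∈ Finset.range (N + 1), 4 * (Nat.gcd a b : ℝ) * levelRadius a b ψ i ^ s := by
        refine Finset.sum_le_sum fun i _ => ?_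
        rw [Finset.sum_congr rfl (g := fun _ => levelRadius a b ψ i ^ s)
          (fun z hz => by rw [(Finset.mem_filter.1 hz).2]), Finset.sum_const, nsmul_eq_mul]
        have := Real.rpow_nonneg (levelRadius_nonneg a b hψ i) s
        gcongr
        exact_mod_cast card_gapLevel_fiber_le ha hab c d i
    _ = 4 * (Nat.gcd a b * ((2 * ψ / Nat.gcd a b) ^ s *
          ∑ i ∈ Finset.range N, ((i + 1 : ℕ) : ℝ) ^ (-s))
          + Nat.gcd a b * (ψ / (a * b)) ^ (s / 2)) := by
        rw [← Finset.mul_sum, Finset.sum_range_succ', hzero, Finset.sum_congr rfl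
          (fun i _ => hsucc i), ← Finset.mul_sum]
        ring
    _ ≤ 4 * (Nat.gcd a b * ((2 * ψ / Nat.gcd a b) ^ s * ((N : ℝ) ^ (1 - s) / (1 - s)))
          + Nat.gcd a b * (ψ / (a * b)) ^ (s / 2)) := by
        gcongr
        exact sum_range_rpow_neg_le hs0 hs1 N
    _ = _ := by
        rw [← mul_div_assoc, ← mul_div_assoc, hscale]
        ring

theorem stmt10 (a b : ℕ → ℕ) (c d : ℕ → ℝ) (ψ : ℕ → ℝ)
    (ha : ∀ n, 1 ≤ a n) (hab : ∀ n, a n ≤ b n) (hψ : ∀ n, 0 ≤ ψ n)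
    (s : ℝ) (hs0 : 0 < s) (hs1 : s < 1)
    (hsum1 : Summable (fun n => (b n : ℝ) * (ψ n / b n) ^ s))
    (hsum2 : Summable (fun n =>
      (Nat.gcd (a n) (b n) : ℝ) * (ψ n / (a n * b n)) ^ (s / 2))) :
    μH[s] {x ∈ Icc (0:ℝ) 1 |
      {n : ℕ | nint (a n * x + c n) * nint (b n * x + d n) < ψ n}.Infinite} = 0 := by
  have hmain := hausdorffMeasure_limsup_eq_zero (X := ℝ) hs0
    (fun n => {x ∈ Icc (0:ℝ) 1 | nint (a n * x + c n) * nint (b n * x + d n) < ψ n})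
    (fun n => nearPairs (a n) (b n) (c n) (d n) ×ˢ (Finset.univ : Finset Bool))
    (fun n z => Metric.closedBall (zeroOf (a n) (b n) (c n) (d n) z)
      (levelRadius (a n) (b n) (ψ n) (gapLevel (a n) (b n) (c n) (d n) z.1)))
    (fun n x hx => mem_iUnion_closedBall_of_nint_mul_lt (ha n) (hab n) (c n) (d n) hx.1 hx.2) ?_
  · refine measure_mono_null (fun x hx => ?_) hmain
    have hset : {n : ℕ | x ∈ {x ∈ Icc (0:ℝ) 1 |
        nint (a n * x + c n) * nint (b n * x + d n) < ψ n}} =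
        {n : ℕ | nint (a n * x + c n) * nint (b n * x + d n) < ψ n} := by
      ext n; exact and_iff_right hx.1
    rw [mem_ofPred_eq, hset]
    exact hx.2
  · have hS : Summable fun n => 2 * 2 ^ s * (4 * (2 ^ s / (1 - s) * ((b n : ℝ) * (ψ n / b n) ^ s)
        + (Nat.gcd (a n) (b n) : ℝ) * (ψ n / (a n * b n)) ^ (s / 2))) :=
      (((hsum1.mul_left _).add hsum2).mul_left 4).mul_left _
    refine ne_top_of_le_ne_top hS.tsum_ofReal_ne_top (ENNReal.tsum_le_tsum fun n => ?_)
    have hr := fun i => levelRadius_nonneg (a n) (b n) (hψ n) i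
    have hdiam : ∀ z : (ℤ × ℤ) × Bool,
        Metric.ediam (Metric.closedBall (zeroOf (a n) (b n) (c n) (d n) z)
          (levelRadius (a n) (b n) (ψ n) (gapLevel (a n) (b n) (c n) (d n) z.1))) ^ s =
        ENNReal.ofReal (2 ^ s *
          levelRadius (a n) (b n) (ψ n) (gapLevel (a n) (b n) (c n) (d n) z.1) ^ s) := by
      intro z
      rw [Real.closedBall_eq_Icc, Real.ediam_Icc,
        add_sub_sub_cancel, ← two_mul, ENNReal.ofReal_rpow_of_nonneg
        (mul_nonneg zero_le_two (hr _)) hs0.le, Real.mul_rpow zero_le_two (hr _)]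
    simp only [hdiam]
    rw [← ENNReal.ofReal_sum_of_nonneg
      (fun z _ => mul_nonneg (by positivity) (Real.rpow_nonneg (hr _) s))]
    refine ENNReal.ofReal_le_ofReal ?_
    rw [Finset.sum_product]
    simp only [Finset.sum_const, Finset.card_univ, Fintype.card_bool, nsmul_eq_mul]
    rw [← Finset.mul_sum, ← Finset.mul_sum, Nat.cast_ofNat, ← mul_assoc]
    gcongr
    exact sum_levelRadius_rpow_le (ha n) (hab n) (c n) (d n) (hψ n) hs0 hs1
end

section
/- Let $a,b\in\mathbb{R}$ with $1<a<b$, set $a_n=a^n$, $b_n=b^n$, and let $\{c_n\},\{d_n\}$ be real sequences and $\psi:\mathbb{N}\to[0,\infty)$. For any $s$ with $\max\{2-\frac{\log b}{\log a},0\}<s<1$, if $\sum_{n\in\mathbb{N}}b^n(\psi(n)/b^n)^s<\infty$, then $\mathcal{H}^s(M(\psi))=0$, where $M(\psi)=\{x\in[0,1]:\|a^nx+c_n\|\cdot\|b^nx+d_n\|<\psi(n)\text{ for infinitely many }n\}$. -/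
open Set MeasureTheory
open scoped ENNReal

/-- The `s`-dimensional Hausdorff content of subsets of a metric space. -/
noncomputable def hausdorffContent (X : Type*) [EMetricSpace X] (s : ℝ) : OuterMeasure X :=
  OuterMeasure.boundedBy fun S => Metric.ediam S ^ s

lemma hausdorffMeasure_eq_zero_of_hausdorffContent {X : Type*} [EMetricSpace X]
    [MeasurableSpace X] [BorelSpace X] {s : ℝ} (hs : 0 < s) {E : Set X}
    (hE : hausdorffContent X s E = 0) : μH[s] E = 0 := by
  have hcover : ∀ n : ℕ, ∃ t : ℕ → Set X, E ⊆ ⋃ i, t i ∧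
      ∑' i, Metric.ediam (t i) ^ s < ((n : ℝ≥0∞) + 1)⁻¹ := by
    intro n
    have hpos : hausdorffContent X s E < ((n : ℝ≥0∞) + 1)⁻¹ := by
      rw [hE, ENNReal.inv_pos]
      exact ENNReal.add_ne_top.2 ⟨ENNReal.natCast_ne_top n, ENNReal.one_ne_top⟩
    rw [hausdorffContent, OuterMeasure.boundedBy_apply] at hpos
    simp only [iInf_lt_iff] at hpos
    obtain ⟨t, ht, hlt⟩ := hpos
    refine ⟨t, ht, lt_of_le_of_lt (ENNReal.tsum_le_tsum fun i => ?_) hlt⟩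
    rcases (t i).eq_empty_or_nonempty with h | h
    · simp [h, hs]
    · simp [h]
  choose t ht hlt using hcover
  have hinv : Filter.Tendsto (fun n : ℕ => ((n : ℝ≥0∞) + 1)⁻¹) Filter.atTop (nhds 0) := by
    have := (Filter.tendsto_add_atTop_iff_nat 1).2 ENNReal.tendsto_inv_nat_nhds_zero
    simpa using this
  have hr : Filter.Tendsto (fun n : ℕ => (((n : ℝ≥0∞) + 1)⁻¹) ^ s⁻¹) Filter.atTop (nhds 0) := by
    have := (ENNReal.continuous_rpow_const (y := s⁻¹)).tendsto 0 |>.comp hinv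
    simpa [Function.comp_def, ENNReal.zero_rpow_of_pos (inv_pos.2 hs)] using this
  have hle := Measure.hausdorffMeasure_le_liminf_tsum s E _ hr t
    (Filter.Eventually.of_forall fun n i =>
      (ENNReal.le_rpow_inv_iff hs).2 ((ENNReal.le_tsum i).trans (hlt n).le))
    (Filter.Eventually.of_forall ht)
  refine nonpos_iff_eq_zero.1 (hle.trans ?_)
  refine (Filter.liminf_le_liminf
    (Filter.Eventually.of_forall fun n => (hlt n).le)).trans_eq hinv.liminf_eq

lemma nint_nonneg (x : ℝ) : 0 ≤ nint x := abs_nonneg _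

lemma nint_le_one (x : ℝ) : nint x ≤ 1 := (abs_sub_round x).trans (by norm_num)

lemma hausdorffContent_Icc_le {s : ℝ} (hs : 0 ≤ s) (u : ℝ) {L : ℝ} (hL : 0 ≤ L) :
    hausdorffContent ℝ s (Icc u (u + L)) ≤ ENNReal.ofReal (L ^ s) := by
  refine (OuterMeasure.boundedBy_le _).trans_eq ?_
  rw [Real.ediam_Icc, add_sub_cancel_left, ENNReal.ofReal_rpow_of_nonneg hL hs]

/-- The points of an interval of length `L` at which `B * x + d` is within `η` of an integer lie
in at most `B * L + 2` intervals of length `2 * η / B`. -/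
lemma measure_inter_nint_le (μ : OuterMeasure ℝ) (S : Set ℝ) {B L η K : ℝ} (d v : ℝ)
    (hB : 0 < B) (hL : 0 ≤ L) (hK0 : 0 ≤ K)
    (hK : ∀ u, μ (S ∩ Icc u (u + 2 * η / B)) ≤ ENNReal.ofReal K) :
    μ (S ∩ Icc v (v + L) ∩ {x | nint (B * x + d) ≤ η}) ≤ ENNReal.ofReal ((B * L + 2) * K) := by
  set I := Finset.Icc (round (B * v + d)) (round (B * (v + L) + d)) with hI
  have hsub : S ∩ Icc v (v + L) ∩ {x | nint (B * x + d) ≤ η} ⊆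
      ⋃ p ∈ I, S ∩ Icc ((p - d - η) / B) ((p - d - η) / B + 2 * η / B) := by
    rintro x ⟨⟨hxS, hx0, hx1⟩, hx⟩
    have hx' : |B * x + d - round (B * x + d)| ≤ η := hx
    rw [abs_le] at hx'
    simp only [mem_iUnion, exists_prop]
    refine ⟨round (B * x + d), ?_, hxS, ?_, ?_⟩
    · rw [hI, Finset.mem_Icc]
      simp only [round_eq]
      constructor <;> apply Int.floor_mono <;> gcongr
    · rw [div_le_iff₀ hB]; linarith
    · rw [← add_div, le_div_iff₀ hB]; linarith
  have hcard : (I.card : ℝ) ≤ B * L + 2 := by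
    have hle : round (B * v + d) ≤ round (B * (v + L) + d) := by
      simp only [round_eq]
      apply Int.floor_mono
      gcongr
      linarith
    have hc : (I.card : ℤ) = round (B * (v + L) + d) + 1 - round (B * v + d) := by
      rw [hI, Int.card_Icc, Int.toNat_of_nonneg (by omega)]
    have hc' : (I.card : ℝ) = round (B * (v + L) + d) + 1 - round (B * v + d) := by
      exact_mod_cast hc
    rw [hc', round_eq, round_eq]
    have h1 := Int.floor_le (B * (v + L) + d + 1 / 2)
    have h2 := Int.lt_floor_add_one (B * v + d + 1 / 2)
    linarith
  calc μ (S ∩ Icc v (v + L) ∩ {x | nint (B * x + d) ≤ η})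
      ≤ ∑ p ∈ I, μ (S ∩ Icc ((p - d - η) / B) ((p - d - η) / B + 2 * η / B)) :=
        (measure_mono hsub).trans (measure_biUnion_finset_le _ _)
    _ ≤ ∑ _p ∈ I, ENNReal.ofReal K := Finset.sum_le_sum fun p _ => hK _
    _ = ENNReal.ofReal (I.card * K) := by
        rw [Finset.sum_const, nsmul_eq_mul, ENNReal.ofReal_mul (by positivity),
          ENNReal.ofReal_natCast]
    _ ≤ ENNReal.ofReal ((B * L + 2) * K) := by gcongr

lemma hausdorffContent_nint_le {s : ℝ} (hs : 0 ≤ s) {A δ : ℝ} (c : ℝ) (hA : 0 < A)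
    (hδ : 0 ≤ δ) (v : ℝ) {L : ℝ} (hL : 0 ≤ L) :
    hausdorffContent ℝ s (Icc v (v + L) ∩ {x | nint (A * x + c) ≤ δ}) ≤
      ENNReal.ofReal ((A * L + 2) * (2 * δ / A) ^ s) := by
  have h := measure_inter_nint_le (hausdorffContent ℝ s) univ (η := δ) (K := (2 * δ / A) ^ s) c v
    hA hL (by positivity) fun u => by
      simpa using hausdorffContent_Icc_le hs u (L := 2 * δ / A) (by positivity)
  simpa using h

lemma hausdorffContent_nint_nint_le {s : ℝ} (hs : 0 ≤ s) {A B δ η : ℝ} (c d : ℝ) (hA : 0 < A)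
    (hB : 0 < B) (hδ : 0 ≤ δ) (hη : 0 ≤ η) :
    hausdorffContent ℝ s
      (Icc 0 1 ∩ {x | nint (A * x + c) ≤ δ} ∩ {x | nint (B * x + d) ≤ η}) ≤
      ENNReal.ofReal ((A + 2) * ((B * (2 * δ / A) + 2) * (2 * η / B) ^ s)) := by
  have h := measure_inter_nint_le (hausdorffContent ℝ s) {x | nint (B * x + d) ≤ η} (L := 1)
    (η := δ) (K := (B * (2 * δ / A) + 2) * (2 * η / B) ^ s) c 0 hA zero_le_one (by positivity)
    fun u => by
      rw [inter_comm]
      exact hausdorffContent_nint_le hs d hB hη u (by positivity)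
  rw [zero_add, mul_one] at h
  refine (measure_mono ?_).trans h
  rintro x ⟨⟨h1, h2⟩, h3⟩
  exact ⟨⟨h3, h1⟩, h2⟩

/-- Cutting at the scales `ρ ^ k`, `k ≤ n`, of the first factor. -/
lemma hausdorffContent_nint_mul_nint_le {s : ℝ} (hs : 0 ≤ s) {A B ρ ψ : ℝ} (c d : ℝ)
    (hA : 0 < A) (hB : 0 < B) (hρ0 : 0 < ρ) (hρ1 : ρ < 1) (hψ : 0 ≤ ψ) (n : ℕ) :
    hausdorffContent ℝ s
      {x ∈ Icc (0 : ℝ) 1 | nint (A * x + c) * nint (B * x + d) < ψ} ≤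
      ENNReal.ofReal ((A + 2) * (2 * ρ ^ n / A) ^ s + ∑ k ∈ Finset.range n,
        (A + 2) * ((B * (2 * ρ ^ k / A) + 2) * (2 * (ψ / ρ ^ (k + 1)) / B) ^ s)) := by
  have hsub : {x ∈ Icc (0 : ℝ) 1 | nint (A * x + c) * nint (B * x + d) < ψ} ⊆
      (Icc 0 1 ∩ {x | nint (A * x + c) ≤ ρ ^ n}) ∪ ⋃ k ∈ Finset.range n,
        Icc 0 1 ∩ {x | nint (A * x + c) ≤ ρ ^ k} ∩ {x | nint (B * x + d) ≤ ψ / ρ ^ (k + 1)} := by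
    rintro x ⟨hx, hlt⟩
    by_cases hn : nint (A * x + c) ≤ ρ ^ n
    · exact Or.inl ⟨hx, hn⟩
    · right
      rw [not_le] at hn
      obtain ⟨k, hk1, hk2⟩ := exists_nat_pow_near_of_lt_one ((pow_pos hρ0 n).trans hn)
        (nint_le_one _) hρ0 hρ1
      have hkn : k < n := (pow_lt_pow_iff_right_of_lt_one₀ hρ0 hρ1).1 (hn.trans_le hk2)
      simp only [mem_iUnion, exists_prop]
      refine ⟨k, Finset.mem_range.2 hkn, ⟨hx, hk2⟩, ?_⟩
      rw [mem_ofPred_eq, le_div_iff₀ (by positivity), mul_comm]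
      exact (mul_le_mul_of_nonneg_right hk1.le (nint_nonneg _)).trans hlt.le
  rw [ENNReal.ofReal_add (by positivity) (Finset.sum_nonneg fun k _ => by positivity),
    ENNReal.ofReal_sum_of_nonneg fun k _ => by positivity]
  refine (measure_mono hsub).trans ((measure_union_le _ _).trans (add_le_add ?_ ?_))
  · simpa using hausdorffContent_nint_le hs c hA (pow_pos hρ0 n).le 0 zero_le_one
  · exact (measure_biUnion_finset_le _ _).trans (Finset.sum_le_sum fun k _ =>
      hausdorffContent_nint_nint_le hs c d hA hB (by positivity) (by positivity))

/-- The covering sum of `hausdorffContent_nint_mul_nint_le`, with `σ = ρ ^ s`. -/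
lemma covering_sum_le {s : ℝ} {A B ρ σ ψ : ℝ} (hA : 1 ≤ A) (hB : 0 < B)
    (hρ0 : 0 < ρ) (hρσ : ρ < σ) (hσ1 : σ < 1) (hσ : ρ ^ s = σ) (hψ : 0 ≤ ψ) (n : ℕ) :
    (A + 2) * (2 * ρ ^ n / A) ^ s + ∑ k ∈ Finset.range n,
        (A + 2) * ((B * (2 * ρ ^ k / A) + 2) * (2 * (ψ / ρ ^ (k + 1)) / B) ^ s) ≤
      3 * 2 ^ s * (A * σ ^ n / A ^ s) +
        6 * (2 / ρ) ^ s * ((1 - ρ / σ)⁻¹ * (B * (ψ / B) ^ s) +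
          n * (A / σ ^ n * (ψ / B) ^ s)) := by
  have hA0 : 0 < A := by linarith
  have hσ0 : 0 < σ := hρ0.trans hρσ
  have hpow : ∀ k : ℕ, (ρ ^ k) ^ s = σ ^ k := fun k => by
    rw [← Real.rpow_natCast, ← Real.rpow_mul hρ0.le, mul_comm, Real.rpow_mul hρ0.le, hσ,
      Real.rpow_natCast]
  set T := (ψ / B) ^ s with hT
  have hT0 : 0 ≤ T := by positivity
  set C := (2 / ρ) ^ s with hC
  have hC0 : 0 ≤ C := by positivity
  refine add_le_add ?_ ?_
  · rw [Real.div_rpow (by positivity) hA0.le, Real.mul_rpow (by norm_num) (by positivity), hpow]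
    calc (A + 2) * (2 ^ s * σ ^ n / A ^ s) ≤ (3 * A) * (2 ^ s * σ ^ n / A ^ s) := by
          gcongr; linarith
      _ = _ := by ring
  · have hterm : ∀ k ∈ Finset.range n,
        (A + 2) * ((B * (2 * ρ ^ k / A) + 2) * (2 * (ψ / ρ ^ (k + 1)) / B) ^ s) ≤
          6 * C * (B * T * (ρ / σ) ^ k + A / σ ^ n * T) := by
      intro k hk
      have h1 : (2 * (ψ / ρ ^ (k + 1)) / B) ^ s = C * T / σ ^ k := by
        rw [show 2 * (ψ / ρ ^ (k + 1)) / B = (2 / ρ) * (ψ / B) / ρ ^ k by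
            rw [pow_succ]; field_simp,
          Real.div_rpow (by positivity) (by positivity), hpow,
          Real.mul_rpow (by positivity) (by positivity)]
      have h2 : A / σ ^ k ≤ A / σ ^ n := by
        refine div_le_div_of_nonneg_left hA0.le (by positivity) ?_
        exact pow_le_pow_of_le_one hσ0.le hσ1.le (Finset.mem_range.1 hk).le
      rw [h1]
      calc (A + 2) * ((B * (2 * ρ ^ k / A) + 2) * (C * T / σ ^ k))
          ≤ (3 * A) * ((B * (2 * ρ ^ k / A) + 2) * (C * T / σ ^ k)) := by
            gcongr; linarith
        _ = 6 * C * (B * T * (ρ / σ) ^ k + A / σ ^ k * T) := by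
            rw [div_pow]; field_simp; ring
        _ ≤ _ := by gcongr
    refine (Finset.sum_le_sum hterm).trans ?_
    rw [← Finset.mul_sum, Finset.sum_add_distrib, ← Finset.mul_sum, Finset.sum_const,
      Finset.card_range, nsmul_eq_mul, mul_comm (B * T)]
    have hq0 : 0 ≤ ρ / σ := by positivity
    have hq1 : ρ / σ < 1 := (div_lt_one hσ0).2 hρσ
    have hgeom : ∑ k ∈ Finset.range n, (ρ / σ) ^ k ≤ (1 - ρ / σ)⁻¹ := by
      rw [← tsum_geometric_of_lt_one hq0 hq1]
      exact (summable_geometric_of_lt_one hq0 hq1).sum_le_tsum _ fun k _ => by positivity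
    gcongr

theorem stmt15 (a b : ℝ) (ha : 1 < a) (hab : a < b) (c d : ℕ → ℝ) (ψ : ℕ → ℝ)
    (hψ : ∀ n, 0 ≤ ψ n) (s : ℝ)
    (hs0 : max (2 - Real.log b / Real.log a) 0 < s) (hs1 : s < 1)
    (hsum : Summable (fun n => b ^ n * (ψ n / b ^ n) ^ s)) :
    μH[s] {x ∈ Icc (0:ℝ) 1 |
      {n : ℕ | nint (a ^ n * x + c n) * nint (b ^ n * x + d n) < ψ n}.Infinite} = 0 := by
  obtain ⟨hs2, hs⟩ := max_lt_iff.1 hs0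
  have ha0 : 0 < a := by linarith
  have hb0 : 0 < b := by linarith
  have hgap : a / b < a ^ s / a := by
    rw [div_lt_div_iff₀ hb0 ha0, ← sq, ← Real.rpow_natCast a 2,
      ← Real.log_lt_log_iff (by positivity) (by positivity),
      Real.log_mul (by positivity) hb0.ne', Real.log_rpow ha0, Real.log_rpow ha0]
    have hla : 0 < Real.log a := Real.log_pos ha
    rw [sub_lt_iff_lt_add, ← sub_lt_iff_lt_add', lt_div_iff₀ hla] at hs2
    push_cast
    linarith
  obtain ⟨σ, hσl, hσu⟩ := exists_between hgap
  have hσ0 : 0 < σ := (by positivity : 0 < a / b).trans hσl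
  have hσ1 : σ < 1 := hσu.trans ((div_lt_one ha0).2 (by
    simpa using Real.rpow_lt_rpow_of_exponent_lt ha hs1))
  set ρ := σ ^ s⁻¹ with hρ
  have hρ0 : 0 < ρ := by positivity
  have hρs : ρ ^ s = σ := by rw [hρ, Real.rpow_inv_rpow hσ0.le hs.ne']
  have hρσ : ρ < σ := by
    simpa using Real.rpow_lt_rpow_of_exponent_gt hσ0 hσ1 ((one_lt_inv₀ hs).2 hs1)
  set T : ℕ → ℝ := fun n => (ψ n / b ^ n) ^ s with hT
  have hT0 : ∀ n, 0 ≤ T n := fun n => by have := hψ n; positivity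
  set M := ∑' n, b ^ n * T n with hM
  have hTM : ∀ n, T n ≤ M / b ^ n := fun n => by
    rw [le_div_iff₀ (by positivity), mul_comm]
    exact hsum.le_tsum n fun k _ => mul_nonneg (by positivity) (hT0 k)
  have hsum₁ : Summable fun n : ℕ => a ^ n * σ ^ n / (a ^ n) ^ s := by
    have hr : a * σ / a ^ s < 1 := by
      rw [div_lt_one (by positivity), mul_comm]
      exact (lt_div_iff₀ ha0).1 hσu
    refine (summable_geometric_of_lt_one (by positivity) hr).congr fun n => ?_
    rw [div_pow, mul_pow, ← Real.rpow_natCast (a ^ s), ← Real.rpow_natCast a, ← Real.rpow_mul ha0.le,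
      ← Real.rpow_mul ha0.le, mul_comm s]
  have hsum₂ : Summable fun n : ℕ => n * (a ^ n / σ ^ n * T n) := by
    have hr : a / (σ * b) < 1 := by
      rw [div_lt_one (by positivity)]
      exact (div_lt_iff₀ hb0).1 hσl
    have hr0 : 0 ≤ a / (σ * b) := by positivity
    have hgeom := summable_pow_mul_geometric_of_norm_lt_one 1
      (show ‖a / (σ * b)‖ < 1 by rwa [Real.norm_of_nonneg hr0])
    refine Summable.of_nonneg_of_le (fun n => ?_) (fun n => ?_) (hgeom.mul_left M)
    · have := hT0 n
      positivity
    · calc (n : ℝ) * (a ^ n / σ ^ n * T n) ≤ n * (a ^ n / σ ^ n * (M / b ^ n)) := by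
            gcongr
            exact hTM n
        _ = M * ((n : ℝ) ^ 1 * (a / (σ * b)) ^ n) := by
            rw [div_pow, mul_pow]; field_simp
  have hbound := (hsum₁.mul_left (3 * 2 ^ s)).add
    (((hsum.mul_left (1 - ρ / σ)⁻¹).add hsum₂).mul_left (6 * (2 / ρ) ^ s))
  have hfin := hbound.tsum_ofReal_ne_top
  set E : ℕ → Set ℝ := fun n =>
    {x ∈ Icc (0 : ℝ) 1 | nint (a ^ n * x + c n) * nint (b ^ n * x + d n) < ψ n} with hE
  have hEfin : ∑' n, hausdorffContent ℝ s (E n) ≠ ∞ := by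
    refine ne_top_of_le_ne_top hfin (ENNReal.tsum_le_tsum fun n => ?_)
    refine (hausdorffContent_nint_mul_nint_le hs.le (c n) (d n) (pow_pos ha0 n) (pow_pos hb0 n)
      hρ0 (hρσ.trans hσ1) (hψ n) n).trans (ENNReal.ofReal_le_ofReal ?_)
    exact covering_sum_le (one_le_pow₀ ha.le) (pow_pos hb0 n) hρ0 hρσ hσ1 hρs (hψ n) n
  refine hausdorffMeasure_eq_zero_of_hausdorffContent hs
    (measure_mono_null ?_ (measure_limsup_cofinite_eq_zero hEfin))
  rintro x ⟨hx, hinf⟩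
  rw [Filter.mem_limsup_iff_frequently_mem, Filter.frequently_cofinite_iff_infinite]
  exact hinf.mono fun n hn => ⟨hx, hn⟩
end
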